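/- For coprime natural numbers m, n with m ≥ 1, the Dirichlet series Σ_{p ≡ n mod m, p prime} p^{-s} converges and defines a regular (holomorphic) function on the open half-plane Re(s) > 1, and there exists a function g(s), holomorphic on the closed half-plane Re(s) ≥ 1, such that Σ_{p ≡ n mod m} p^{-s} = (1/φ(m)) · log(1/(s−1)) + g(s) for Re(s) > 1, where φ is Euler's totient function. -/

import Mathlib

open Complex Metric Set Filter Topology

/-- Locally, a logarithm on the half-plane `re s > 1` of a function that is holomorphic and
nonvanishing near a point of the line `re s = 1` extends across that point. -/
lemma exists_ball_extension_of_exp_eq {L ℓ : ℂ → ℂ} (hL : Differentiable ℂ L)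
    (hℓ : DifferentiableOn ℂ ℓ {s | 1 < s.re}) (hexp : ∀ s, 1 < s.re → exp (ℓ s) = L s)
    {c : ℂ} (hc : c.re = 1) (hLc : L c ≠ 0) :
    ∃ r > 0, ∃ F : ℂ → ℂ, DifferentiableOn ℂ F (ball c r) ∧
      EqOn F ℓ (ball c r ∩ {s | 1 < s.re}) := by
  have hopen : IsOpen {s : ℂ | 1 < s.re} := isOpen_lt continuous_const continuous_re
  obtain ⟨r, hr, hball⟩ := Metric.eventually_nhds_iff_ball.mp
    (hL.continuous.continuousAt.eventually_ne hLc)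
  have hd : DifferentiableOn ℂ (fun z ↦ deriv L z / L z) (ball c r) :=
    (hL.differentiableOn.deriv isOpen_univ |>.mono (subset_univ _)).div hL.differentiableOn hball
  have hx : c + (r / 2 : ℝ) ∈ ball c r ∩ {s | 1 < s.re} := by
    refine ⟨?_, ?_⟩
    · simp only [mem_ball, dist_eq, add_sub_cancel_left, norm_real, Real.norm_eq_abs]
      rw [abs_of_pos (by positivity)]
      linarith
    · simp only [mem_ofPred_eq, add_re, ofReal_re, hc]
      linarith
  obtain ⟨F, hFx, hF⟩ := hd.isExactOn_ball.with_val_at (c + (r / 2 : ℝ)) (ℓ (c + (r / 2 : ℝ)))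
  have hFd : DifferentiableOn ℂ F (ball c r) :=
    fun z hz ↦ (hF z hz).differentiableAt.differentiableWithinAt
  refine ⟨r, hr, F, hFd, ?_⟩
  refine (isOpen_ball.inter hopen).eqOn_of_deriv_eq
    ((convex_ball c r).inter (convex_halfSpace_re_gt 1)).isPreconnected
    (hFd.mono inter_subset_left) (hℓ.mono inter_subset_right) (fun z hz ↦ ?_) hx hFx
  have hℓz : DifferentiableAt ℂ ℓ z := hℓ.differentiableAt (hopen.mem_nhds hz.2)
  have hev : (fun s ↦ exp (ℓ s)) =ᶠ[𝓝 z] L :=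
    eventually_of_mem (hopen.mem_nhds hz.2) hexp
  have hderiv := hℓz.hasDerivAt.cexp.deriv
  rw [hev.deriv_eq, hexp z hz.2] at hderiv
  rw [(hF z hz.1).deriv, hderiv, mul_div_cancel_left₀ _ (hball z hz.1)]

/-- A holomorphic function on `re s > 1` which extends holomorphically to a disk around each point
of the line `re s = 1` extends holomorphically to the closed half-plane `re s ≥ 1`. -/
lemma exists_extension_of_forall_ball {ℓ : ℂ → ℂ} (hℓ : DifferentiableOn ℂ ℓ {s | 1 < s.re})
    (h : ∀ c : ℂ, c.re = 1 → ∃ r > 0, ∃ F : ℂ → ℂ, DifferentiableOn ℂ F (ball c r) ∧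
      EqOn F ℓ (ball c r ∩ {s | 1 < s.re})) :
    ∃ g : ℂ → ℂ, (∀ s, 1 ≤ s.re → DifferentiableAt ℂ g s) ∧ ∀ s, 1 < s.re → g s = ℓ s := by
  classical
  have hopen : IsOpen {s : ℂ | 1 < s.re} := isOpen_lt continuous_const continuous_re
  choose! r hr F hFd hF using h
  have overlap {c d s : ℂ} (hc : c.re = 1) (hd : d.re = 1) (hsc : s ∈ ball c (r c))
      (hsd : s ∈ ball d (r d)) : F c s = F d s := by
    set U := ball c (r c) ∩ ball d (r d)
    have hUo : IsOpen U := isOpen_ball.inter isOpen_ball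
    obtain ⟨z, hzU, hz⟩ : ∃ z ∈ U, 1 < z.re := by
      -- reflect `s` in the line and move slightly to the right
      obtain ⟨t, htU, ht⟩ : ∃ t ∈ U, 1 ≤ t.re := by
        rcases le_total 1 s.re with hs | hs
        · exact ⟨s, ⟨hsc, hsd⟩, hs⟩
        have key {b : ℂ} (hb : b.re = 1) : dist (⟨2 - s.re, s.im⟩ : ℂ) b = dist s b := by
          rw [dist_eq_re_im, dist_eq_re_im, hb]
          ring_nf
        refine ⟨⟨2 - s.re, s.im⟩, ⟨?_, ?_⟩, ?_⟩
        · rwa [mem_ball, key hc]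
        · rwa [mem_ball, key hd]
        · change 1 ≤ 2 - s.re
          linarith
      obtain ⟨ε, hε, hεU⟩ := Metric.isOpen_iff.mp hUo t htU
      refine ⟨t + (ε / 2 : ℝ), hεU ?_, ?_⟩
      · simp only [mem_ball, dist_eq, add_sub_cancel_left, norm_real, Real.norm_eq_abs]
        rw [abs_of_pos (by positivity)]
        linarith
      · simp only [add_re, ofReal_re]
        linarith
    have hFc : AnalyticOnNhd ℂ (F c) U := (hFd c hc).mono inter_subset_left |>.analyticOnNhd hUo
    have hFd' : AnalyticOnNhd ℂ (F d) U := (hFd d hd).mono inter_subset_right |>.analyticOnNhd hUo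
    refine hFc.eqOn_of_preconnected_of_eventuallyEq hFd'
      ((convex_ball _ _).inter (convex_ball _ _)).isPreconnected hzU ?_ ⟨hsc, hsd⟩
    filter_upwards [(hUo.inter hopen).mem_nhds ⟨hzU, hz⟩] with w hw
    rw [hF c hc ⟨hw.1.1, hw.2⟩, hF d hd ⟨hw.1.2, hw.2⟩]
  let g : ℂ → ℂ := fun s ↦
    if 1 < s.re then ℓ s
    else if hs : ∃ c : ℂ, c.re = 1 ∧ s ∈ ball c (r c) then F hs.choose s else 0
  have hgℓ (s : ℂ) (hs : 1 < s.re) : g s = ℓ s := if_pos hs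
  refine ⟨g, fun s hs ↦ ?_, hgℓ⟩
  rcases hs.lt_or_eq with hs | hs
  · exact (hℓ.differentiableAt (hopen.mem_nhds hs)).congr_of_eventuallyEq
      (eventually_of_mem (hopen.mem_nhds hs) hgℓ)
  · have hnhds : ball s (r s) ∈ 𝓝 s := ball_mem_nhds s (hr s hs.symm)
    refine ((hFd s hs.symm).differentiableAt hnhds).congr_of_eventuallyEq ?_
    filter_upwards [hnhds] with w hw
    by_cases hw1 : 1 < w.re
    · rw [hgℓ w hw1, hF s hs.symm ⟨hw, hw1⟩]
    · have hex : ∃ c : ℂ, c.re = 1 ∧ w ∈ ball c (r c) := ⟨s, hs.symm, hw⟩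
      simp only [g, if_neg hw1, dif_pos hex]
      exact overlap hex.choose_spec.1 hs.symm hex.choose_spec.2 hw

/-- A holomorphic logarithm on `re s > 1` of an entire function without zeros in the closed
half-plane `re s ≥ 1` extends holomorphically to that closed half-plane. -/
lemma exists_extension_of_exp_eq {L ℓ : ℂ → ℂ} (hL : Differentiable ℂ L)
    (hL0 : ∀ s, 1 ≤ s.re → L s ≠ 0) (hℓ : DifferentiableOn ℂ ℓ {s | 1 < s.re})
    (hexp : ∀ s, 1 < s.re → exp (ℓ s) = L s) :
    ∃ g : ℂ → ℂ, (∀ s, 1 ≤ s.re → DifferentiableAt ℂ g s) ∧ ∀ s, 1 < s.re → g s = ℓ s :=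
  exists_extension_of_forall_ball hℓ fun c hc ↦
    exists_ball_extension_of_exp_eq hL hℓ hexp hc (hL0 c hc.ge)

namespace DirichletCharacter

variable {N : ℕ} (χ : DirichletCharacter ℂ N)

lemma norm_mul_prime_cpow_le (p : Nat.Primes) {s : ℂ} {x : ℝ} (hs : x ≤ s.re) :
    ‖χ p * (p : ℂ) ^ (-s)‖ ≤ (p : ℝ) ^ (-x) := by
  rw [norm_mul, norm_natCast_cpow_of_pos p.prop.pos, neg_re]
  calc _ ≤ 1 * (p : ℝ) ^ (-s.re) := by gcongr; exact χ.norm_le_one _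
    _ ≤ _ := by
      rw [one_mul]
      exact Real.rpow_le_rpow_of_exponent_le (mod_cast p.prop.one_le) (neg_le_neg hs)

lemma differentiable_mul_prime_cpow (p : Nat.Primes) :
    Differentiable ℂ fun s : ℂ ↦ χ p * (p : ℂ) ^ (-s) := by
  have : (p : ℂ) ≠ 0 := mod_cast p.prop.ne_zero
  exact fun s ↦ (differentiableAt_id.neg.const_cpow (.inl this)).const_mul _

lemma summable_mul_prime_cpow {s : ℂ} (hs : 1 < s.re) :
    Summable fun p : Nat.Primes ↦ χ p * (p : ℂ) ^ (-s) :=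
  .of_norm_bounded (Nat.Primes.summable_rpow.mpr (by linarith : -s.re < -1))
    fun p ↦ χ.norm_mul_prime_cpow_le p le_rfl

lemma differentiableOn_tsum_mul_prime_cpow :
    DifferentiableOn ℂ (fun s : ℂ ↦ ∑' p : Nat.Primes, χ p * (p : ℂ) ^ (-s)) {s | 1 < s.re} := by
  intro s (hs : 1 < s.re)
  obtain ⟨x, hx, hxs⟩ := exists_between hs
  have hopen : IsOpen {s : ℂ | x < s.re} := isOpen_lt continuous_const continuous_re
  exact (differentiableOn_tsum_of_summable_norm
    (Nat.Primes.summable_rpow.mpr (by linarith : -x < -1))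
    (fun p ↦ (χ.differentiable_mul_prime_cpow p).differentiableOn) hopen
    (fun p w (hw : x < w.re) ↦ χ.norm_mul_prime_cpow_le p hw.le)).differentiableAt
      (hopen.mem_nhds hxs) |>.differentiableWithinAt

/-- The contribution of the proper prime powers to the logarithm of the Euler product is
holomorphic on `re s > 1 / 2`. -/
lemma differentiableOn_tsum_neg_log_sub :
    DifferentiableOn ℂ
      (fun s : ℂ ↦ ∑' p : Nat.Primes, (-log (1 - χ p * (p : ℂ) ^ (-s)) - χ p * (p : ℂ) ^ (-s)))
      {s | 1 / 2 < s.re} := by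
  intro s (hs : 1 / 2 < s.re)
  obtain ⟨x, hx, hxs⟩ := exists_between hs
  have hopen : IsOpen {s : ℂ | x < s.re} := isOpen_lt continuous_const continuous_re
  have hlt (p : Nat.Primes) : (p : ℝ) ^ (-x) ≤ (2 : ℝ) ^ (-x) :=
    Real.rpow_le_rpow_of_nonpos two_pos (mod_cast p.prop.two_le) (by linarith)
  have h2 : (2 : ℝ) ^ (-x) < 1 := Real.rpow_lt_one_of_one_lt_of_neg one_lt_two (by linarith)
  have hsum : Summable fun p : Nat.Primes ↦ (p : ℝ) ^ (-(2 * x)) * ((1 - 2 ^ (-x))⁻¹ / 2) :=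
    (Nat.Primes.summable_rpow.mpr (by linarith : -(2 * x) < -1)).mul_right _
  refine (differentiableOn_tsum_of_summable_norm hsum (fun p w hw ↦ ?_) hopen
    (fun p w hw ↦ ?_)).differentiableAt (hopen.mem_nhds hxs) |>.differentiableWithinAt
  all_goals
    have hz := χ.norm_mul_prime_cpow_le p (le_of_lt hw)
    have hz1 := (hz.trans (hlt p)).trans_lt h2
  · refine DifferentiableAt.differentiableWithinAt ?_
    have hd := χ.differentiable_mul_prime_cpow p w
    exact ((hd.const_sub 1).clog (by
      rw [sub_eq_add_neg]
      exact mem_slitPlane_of_norm_lt_one (by rwa [norm_neg]))).neg.sub hd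
  · set z := χ p * (p : ℂ) ^ (-w)
    have hlog : -log (1 - z) - z = -(log (1 + -z) - -z) := by rw [← sub_eq_add_neg]; ring
    rw [hlog, norm_neg]
    refine (norm_log_one_add_sub_self_le (by rwa [norm_neg])).trans ?_
    rw [norm_neg, mul_div_assoc, two_mul, neg_add, Real.rpow_add (mod_cast p.prop.pos), ← pow_two]
    have := hz.trans (hlt p)
    have : 0 < 1 - (2 : ℝ) ^ (-x) := by linarith
    gcongr

lemma exp_tsum_mul_prime_cpow_add_tsum [NeZero N] {s : ℂ} (hs : 1 < s.re) :
    exp ((∑' p : Nat.Primes, χ p * (p : ℂ) ^ (-s)) +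
      ∑' p : Nat.Primes, (-log (1 - χ p * (p : ℂ) ^ (-s)) - χ p * (p : ℂ) ^ (-s))) =
      LFunction χ s := by
  have h1 := χ.summable_mul_prime_cpow hs
  rw [← h1.tsum_add ((χ.summable_neg_log_one_sub_mul_prime_cpow hs).sub h1),
    LFunction_eq_LSeries χ hs, ← LSeries_eulerProduct_exp_log χ hs]
  simp only [add_sub_cancel]

open scoped Classical in
/-- The prime sum twisted by a Dirichlet character extends holomorphically to `re s ≥ 1`, up to
the singularity `log (1 / (s - 1))` in the case of the trivial character. -/
lemma exists_tsum_mul_prime_cpow_eq [NeZero N] :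
    ∃ g : ℂ → ℂ, (∀ s, 1 ≤ s.re → DifferentiableAt ℂ g s) ∧ ∀ s, 1 < s.re →
      ∑' p : Nat.Primes, χ p * (p : ℂ) ^ (-s) =
        (if χ = 1 then log (1 / (s - 1)) else 0) + g s := by
  set P : ℂ → ℂ := fun s ↦ ∑' p : Nat.Primes, χ p * (p : ℂ) ^ (-s)
  set R : ℂ → ℂ := fun s ↦
    ∑' p : Nat.Primes, (-log (1 - χ p * (p : ℂ) ^ (-s)) - χ p * (p : ℂ) ^ (-s))
  have hP : DifferentiableOn ℂ P {s | 1 < s.re} := χ.differentiableOn_tsum_mul_prime_cpow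
  have hR : DifferentiableOn ℂ R {s | 1 / 2 < s.re} := χ.differentiableOn_tsum_neg_log_sub
  have hRd (s : ℂ) (hs : 1 ≤ s.re) : DifferentiableAt ℂ R s :=
    hR.differentiableAt <| (isOpen_lt continuous_const continuous_re).mem_nhds
      (by simp only [mem_ofPred_eq]; linarith : s ∈ {s : ℂ | 1 / 2 < s.re})
  have hPR : DifferentiableOn ℂ (fun s ↦ P s + R s) {s | 1 < s.re} :=
    fun s hs ↦ (hP s hs).add (hRd s (le_of_lt hs)).differentiableWithinAt
  have hexp (s : ℂ) (hs : 1 < s.re) : exp (P s + R s) = LFunction χ s :=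
    χ.exp_tsum_mul_prime_cpow_add_tsum hs
  by_cases hχ : χ = 1
  · have hslit (s : ℂ) (hs : 1 < s.re) : s - 1 ∈ slitPlane :=
      .inl (by simpa using hs)
    have hne (s : ℂ) (hs : 1 < s.re) : s ≠ 1 := fun h ↦ by simp [h] at hs
    have hne' (s : ℂ) (hs : 1 ≤ s.re) : LFunctionTrivChar₁ N s ≠ 0 := by
      rcases eq_or_ne s 1 with rfl | h1
      · exact LFunctionTrivChar₁_apply_one_ne_zero N
      · rw [LFunctionTrivChar₁, Function.update_of_ne h1]
        exact mul_ne_zero (sub_ne_zero.mpr h1) (LFunction_ne_zero_of_one_le_re 1 (.inr h1) hs)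
    have hlog : DifferentiableOn ℂ (fun s ↦ P s + R s + log (s - 1)) {s | 1 < s.re} :=
      fun s hs ↦ (hPR s hs).add
        ((differentiableAt_id.sub_const 1).clog (hslit s hs)).differentiableWithinAt
    obtain ⟨g, hg, hgeq⟩ := exists_extension_of_exp_eq (differentiable_LFunctionTrivChar₁ N)
      hne' hlog fun s hs ↦ by
        rw [exp_add, hexp s hs, exp_log (sub_ne_zero.mpr (hne s hs)), LFunctionTrivChar₁,
          Function.update_of_ne (hne s hs), hχ, mul_comm]
    refine ⟨fun s ↦ g s - R s, fun s hs ↦ (hg s hs).sub (hRd s hs), fun s hs ↦ ?_⟩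
    change P s = _ + (g s - R s)
    rw [if_pos hχ, hgeq s hs, one_div, log_inv _ (slitPlane_arg_ne_pi (hslit s hs))]
    ring
  · obtain ⟨g, hg, hgeq⟩ := exists_extension_of_exp_eq (differentiable_LFunction hχ)
      (fun s hs ↦ LFunction_ne_zero_of_one_le_re χ (.inl hχ) hs) hPR hexp
    refine ⟨fun s ↦ g s - R s, fun s hs ↦ (hg s hs).sub (hRd s hs), fun s hs ↦ ?_⟩
    simp only [hχ, if_false, hgeq s hs]
    ring

/-- Orthogonality of characters isolates the primes in an invertible residue class. -/
lemma tsum_primes_residueClass_eq [NeZero N] {a : ZMod N} (ha : IsUnit a) {s : ℂ}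
    (hs : 1 < s.re) :
    ∑' p : Nat.Primes, {p : Nat.Primes | ((p : ℕ) : ZMod N) = a}.indicator
        (fun p ↦ (p : ℂ) ^ (-s)) p =
      (N.totient : ℂ)⁻¹ * ∑ χ : DirichletCharacter ℂ N,
        χ a⁻¹ * ∑' p : Nat.Primes, χ p * (p : ℂ) ^ (-s) := by
  have hN : (N.totient : ℂ) ≠ 0 := mod_cast (Nat.totient_pos.mpr N.pos_of_neZero).ne'
  simp_rw [← tsum_mul_left]
  rw [← Summable.tsum_finsetSum fun χ _ ↦ (χ.summable_mul_prime_cpow hs).mul_left _,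
    ← tsum_mul_left]
  refine tsum_congr fun p ↦ ?_
  simp only [← mul_assoc, ← Finset.sum_mul, sum_char_inv_mul_char_eq ℂ ha, indicator_apply,
    mem_ofPred_eq, eq_comm (a := a)]
  split_ifs <;> simp [hN]

end DirichletCharacter

/-- For coprime `m ≥ 1` and `n`, the Dirichlet series `Σ_{p ≡ n mod m} p^{-s}` (over primes)
converges and is holomorphic on `Re(s) > 1`, and there is a function `g` holomorphic on the
closed half-plane `Re(s) ≥ 1` with
`Σ_{p ≡ n mod m} p^{-s} = (1/φ(m)) log(1/(s-1)) + g(s)` for `Re(s) > 1`. -/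
theorem stmt6 (m n : ℕ) (hm : 1 ≤ m) (hmn : Nat.Coprime m n) :
    (∀ s : ℂ, 1 < s.re →
      Summable (fun p : {p : ℕ // p.Prime ∧ p % m = n % m} => ((p : ℕ) : ℂ) ^ (-s))) ∧
    DifferentiableOn ℂ
      (fun s : ℂ => ∑' p : {p : ℕ // p.Prime ∧ p % m = n % m}, ((p : ℕ) : ℂ) ^ (-s))
      {s : ℂ | 1 < s.re} ∧
    ∃ g : ℂ → ℂ, (∀ s : ℂ, 1 ≤ s.re → DifferentiableAt ℂ g s) ∧
      ∀ s : ℂ, 1 < s.re →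
        (∑' p : {p : ℕ // p.Prime ∧ p % m = n % m}, ((p : ℕ) : ℂ) ^ (-s)) =
          (1 / (m.totient : ℂ)) * Complex.log (1 / (s - 1)) + g s := by
  classical
  have : NeZero m := ⟨by omega⟩
  have ha : IsUnit (n : ZMod m) := (ZMod.isUnit_iff_coprime n m).mpr hmn.symm
  have ha' : IsUnit (n : ZMod m)⁻¹ := isUnit_of_dvd_one ⟨n, (ZMod.inv_mul_of_unit _ ha).symm⟩
  have hclass (s : ℂ) : (∑' p : {p : ℕ // p.Prime ∧ p % m = n % m}, ((p : ℕ) : ℂ) ^ (-s)) =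
      ∑' p : Nat.Primes, {p : Nat.Primes | ((p : ℕ) : ZMod m) = n}.indicator
        (fun p ↦ (p : ℂ) ^ (-s)) p := by
    rw [← tsum_subtype]
    let e : {p : ℕ // p.Prime ∧ p % m = n % m} ≃
        {p : Nat.Primes | ((p : ℕ) : ZMod m) = n} :=
      (Equiv.subtypeSubtypeEquivSubtypeInter Nat.Prime (fun p ↦ p % m = n % m)).symm.trans
        (Equiv.subtypeEquivRight fun p ↦ (ZMod.natCast_eq_natCast_iff' p n m).symm)
    exact e.tsum_eq (fun p ↦ ((p : Nat.Primes) : ℂ) ^ (-s))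
  choose g hg hgeq using
    fun χ : DirichletCharacter ℂ m ↦ χ.exists_tsum_mul_prime_cpow_eq
  set G : ℂ → ℂ := fun s ↦
    (m.totient : ℂ)⁻¹ * ∑ χ : DirichletCharacter ℂ m, χ (n : ZMod m)⁻¹ * g χ s
  have hG (s : ℂ) (hs : 1 ≤ s.re) : DifferentiableAt ℂ G s :=
    (DifferentiableAt.fun_sum fun χ _ ↦ (hg χ s hs).const_mul _).const_mul _
  have heq (s : ℂ) (hs : 1 < s.re) :
      (∑' p : {p : ℕ // p.Prime ∧ p % m = n % m}, ((p : ℕ) : ℂ) ^ (-s)) =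
        (1 / (m.totient : ℂ)) * log (1 / (s - 1)) + G s := by
    rw [hclass s, DirichletCharacter.tsum_primes_residueClass_eq ha hs]
    simp only [hgeq _ s hs, mul_add, Finset.sum_add_distrib, mul_ite, mul_zero,
      Finset.sum_ite_eq', Finset.mem_univ, if_true, MulChar.one_apply ha', one_mul, one_div, G]
  refine ⟨fun s hs ↦ ?_, fun s hs ↦ ?_, G, hG, heq⟩
  · refine .of_norm_bounded
      ((Real.summable_nat_rpow.mpr (by linarith : -s.re < -1)).subtype _) fun p ↦ ?_
    rw [Complex.norm_natCast_cpow_of_pos p.2.1.pos, neg_re]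
    rfl
  · have hs1 : s - 1 ≠ 0 := fun h ↦ by
      rw [sub_eq_zero.mp h] at hs
      simp at hs
    have hslit : 1 / (s - 1) ∈ slitPlane := by
      refine .inl ?_
      rw [one_div, inv_re]
      exact div_pos (by simpa using hs) (normSq_pos.mpr hs1)
    have hd : DifferentiableAt ℂ
        (fun s ↦ (1 / (m.totient : ℂ)) * log (1 / (s - 1)) + G s) s := by
      have := hG s (le_of_lt hs)
      fun_prop (disch := assumption)
    exact hd.differentiableWithinAt.congr heq (heq s hs)
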